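/- There exists a constant C > 0 such that for every ε > 0 there exists N such that for all n ≥ N and every odd prime q with q ≤ n^{1/2}/(log n)^C, the expected number of vectors a ∈ (ℤ/qℤ)^n with M_n · a = 0 (the product taken over ℤ/qℤ) is at most 2 + ε. -/

import Mathlib

/-- The random symmetric ±1 matrix: the upper-triangular entries
(including diagonal) are determined by independent fair coin flips
`σ i j` for `i ≤ j`, and the matrix is symmetric. -/
def signMatrix (n : ℕ) (σ : Fin n → Fin n → Bool) : Matrix (Fin n) (Fin n) ℤ :=
  fun i j => if σ (min i j) (max i j) then 1 else -1

/-- The expected number of vectors `a ∈ (ℤ/qℤ)^n` in the kernel of the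
random symmetric ±1 matrix reduced mod `q`. -/
noncomputable def expKernel (n q : ℕ) : ℝ :=
  (∑ σ : Fin n → Fin n → Bool,
      (Nat.card {a : Fin n → ZMod q //
        ((signMatrix n σ).map (Int.cast : ℤ → ZMod q)).mulVec a = 0} : ℝ)) /
    Fintype.card (Fin n → Fin n → Bool)

open Finset

/-- The number of ordered pairs of indices at which the symmetric form
`a i * b j + a j * b i` does not vanish. -/
def nonorthCount {ι K : Type*} [Fintype ι] [Field K] [DecidableEq K] (a b : ι → K) : ℕ :=
  #{p : ι × ι | a p.1 * b p.2 + a p.2 * b p.1 ≠ 0}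

section Combinatorics

variable {ι K : Type*} [Fintype ι] [Field K] [DecidableEq K]

theorem nonorthCount_comm (a b : ι → K) : nonorthCount a b = nonorthCount b a := by
  unfold nonorthCount
  congr 1
  ext p
  simp only [mem_filter, mem_univ, true_and]
  rw [show a p.1 * b p.2 + a p.2 * b p.1 = b p.1 * a p.2 + b p.2 * a p.1 by ring]

theorem card_mul_card_le_nonorthCount (a b : ι → K) :
    #{i | a i ≠ 0 ∧ b i = 0} * #{i | b i ≠ 0} ≤ nonorthCount a b := by
  rw [← card_product]
  refine card_le_card fun p hp => ?_
  simp only [mem_product, mem_filter, mem_univ, true_and] at hp ⊢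
  simp [hp.1.1, hp.1.2, hp.2]

theorem sq_card_le_nonorthCount (h2 : (2 : K) ≠ 0) (a b : ι → K)
    (ha : 2 * #{i | a i ≠ 0 ∧ b i = 0} ≤ #{i | a i ≠ 0 ∨ b i ≠ 0})
    (hb : 2 * #{i | b i ≠ 0 ∧ a i = 0} ≤ #{i | a i ≠ 0 ∨ b i ≠ 0}) :
    #{i | a i ≠ 0 ∨ b i ≠ 0} ^ 2 ≤ 4 * nonorthCount a b := by
  set Z : Finset ι := {i | a i ≠ 0 ∨ b i ≠ 0} with hZ
  let O : ι → Finset ι := fun i => {j ∈ Z | a i * b j + a j * b i = 0}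
  by_cases h : ∃ i ∈ Z, #Z < 2 * #(O i)
  · obtain ⟨i, hi, hlt⟩ := h
    have hai : a i ≠ 0 := by
      intro h0
      have hbi : b i ≠ 0 := by simpa [hZ, h0] using hi
      have : O i ⊆ ({i | b i ≠ 0 ∧ a i = 0} : Finset ι) := by
        intro j hj
        simp only [O, hZ, mem_filter, mem_univ, true_and, h0, zero_mul, zero_add,
          mul_eq_zero, hbi, or_false] at hj ⊢
        tauto
      have := card_le_card this
      omega
    have hbi : b i ≠ 0 := by
      intro h0
      have : O i ⊆ ({i | a i ≠ 0 ∧ b i = 0} : Finset ι) := by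
        intro j hj
        simp only [O, hZ, mem_filter, mem_univ, true_and, h0, mul_zero, add_zero,
          mul_eq_zero, hai, false_or] at hj ⊢
        tauto
      have := card_le_card this
      omega
    have hsub : O i ×ˢ O i ⊆
        ({p : ι × ι | a p.1 * b p.2 + a p.2 * b p.1 ≠ 0} : Finset (ι × ι)) := by
      rintro ⟨j, k⟩ hp
      simp only [O, hZ, mem_product, mem_filter, mem_univ, true_and] at hp ⊢
      obtain ⟨⟨hj, hj'⟩, hk, hk'⟩ := hp
      have hbj : b j ≠ 0 := by
        intro h0
        simp [h0, hbi] at hj' hj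
        exact hj hj'
      have hbk : b k ≠ 0 := by
        intro h0
        simp [h0, hbi] at hk' hk
        exact hk hk'
      intro h0
      have : 2 * (a i * b j * b k) = 0 := by
        linear_combination b k * hj' + b j * hk' - b i * h0
      simp_all
    have := card_le_card hsub
    rw [card_product] at this
    unfold nonorthCount
    nlinarith
  · push Not at h
    have hsub : #(Z.sigma (fun i => {j ∈ Z | ¬ (a i * b j + a j * b i = 0)})) ≤
        nonorthCount a b := by
      refine card_le_card_of_injOn (fun p => (p.1, p.2)) ?_ ?_
      · intro p hp
        simp only [coe_sigma, Set.mem_sigma_iff, mem_coe, mem_filter] at hp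
        simpa using hp.2.2
      · rintro ⟨i, j⟩ _ ⟨i', j'⟩ _ h
        simpa using h
    rw [card_sigma] at hsub
    have hge : ∀ i ∈ Z, #Z ≤ 2 * #{j ∈ Z | ¬ (a i * b j + a j * b i = 0)} := by
      intro i hi
      have h1 := h i hi
      have h2 := card_filter_add_card_filter_not (s := Z) (fun j => a i * b j + a j * b i = 0)
      simp only [O] at h1
      omega
    have := sum_le_sum hge
    rw [← mul_sum, sum_const, smul_eq_mul] at this
    nlinarith

theorem nonorthCount_trichotomy (h2 : (2 : K) ≠ 0) (a b : ι → K) :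
    #{i | a i ≠ 0 ∨ b i ≠ 0} ^ 2 ≤ 4 * nonorthCount a b ∨
    #{i | a i ≠ 0 ∨ b i ≠ 0} * #{i | b i ≠ 0} ≤ 2 * nonorthCount a b ∨
    #{i | a i ≠ 0 ∨ b i ≠ 0} * #{i | a i ≠ 0} ≤ 2 * nonorthCount a b := by
  by_cases ha : 2 * #{i | a i ≠ 0 ∧ b i = 0} ≤ #{i | a i ≠ 0 ∨ b i ≠ 0}
  · by_cases hb : 2 * #{i | b i ≠ 0 ∧ a i = 0} ≤ #{i | a i ≠ 0 ∨ b i ≠ 0}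
    · exact .inl (sq_card_le_nonorthCount h2 a b ha hb)
    · right; right
      have := card_mul_card_le_nonorthCount b a
      rw [nonorthCount_comm] at this
      nlinarith
  · right; left
    have := card_mul_card_le_nonorthCount a b
    nlinarith

theorem sum_pow_card_ne_zero [Fintype K] (ι : Type*) [Fintype ι] [DecidableEq ι] (x : ℝ) :
    ∑ b : ι → K, x ^ #{i | b i ≠ 0} = (1 + (Fintype.card K - 1) * x) ^ Fintype.card ι := by
  have h1 : ∀ b : ι → K, x ^ #{i | b i ≠ 0} = ∏ i, if b i ≠ 0 then x else 1 := by
    intro b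
    rw [prod_ite]; simp
  simp_rw [h1]
  rw [← Fintype.piFinset_univ, ← prod_univ_sum (fun _ : ι => (univ : Finset K))
    (fun _ c => if c ≠ 0 then x else 1), prod_const, card_univ]
  congr 1
  rw [← add_sum_erase _ _ (mem_univ (0 : K)), sum_congr rfl (g := fun _ => x)]
  · simp [card_erase_of_mem, Nat.cast_sub Fintype.card_pos]
  · intro c hc
    simp [ne_of_mem_erase hc]

theorem sum_pow_card_support_pair [Fintype K] (ι : Type*) [Fintype ι] [DecidableEq ι] (y : ℝ) :
    ∑ a : ι → K, ∑ b : ι → K, y ^ #{i | a i ≠ 0 ∨ b i ≠ 0} =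
      (1 + ((Fintype.card K : ℝ) ^ 2 - 1) * y) ^ Fintype.card ι := by
  have h1 : ∀ a b : ι → K, y ^ #{i | a i ≠ 0 ∨ b i ≠ 0} =
      ∏ i, if (a i, b i) ≠ 0 then y else 1 := by
    intro a b
    rw [prod_ite]; simp [Prod.ext_iff, or_iff_not_imp_left]
  simp_rw [h1]
  rw [← Fintype.sum_prod_type' (f := fun a b : ι → K => ∏ i, if (a i, b i) ≠ 0 then y else 1),
    ← (Equiv.arrowProdEquivProdArrow ι (fun _ => K) (fun _ => K)).sum_comp]
  simp only [Equiv.arrowProdEquivProdArrow_apply, Prod.mk.eta]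
  rw [← Fintype.piFinset_univ, ← prod_univ_sum (fun _ : ι => (univ : Finset (K × K)))
    (fun _ c => if c ≠ 0 then y else 1), prod_const, card_univ]
  congr 1
  rw [← add_sum_erase _ _ (mem_univ (0 : K × K)), sum_congr rfl (g := fun _ => y)]
  · have : 1 ≤ Fintype.card K * Fintype.card K := Nat.mul_pos Fintype.card_pos Fintype.card_pos
    simp [card_erase_of_mem, Nat.cast_sub this, sq]
  · intro c hc
    simp [ne_of_mem_erase hc]

end Combinatorics

section Fourier

theorem addChar_map_sum {ι A R : Type*} [AddCommMonoid A] [CommMonoid R] (ψ : AddChar A R)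
    (s : Finset ι) (f : ι → A) : ψ (∑ i ∈ s, f i) = ∏ i ∈ s, ψ (f i) := by
  classical
  induction s using Finset.induction_on with
  | empty => simp
  | insert i s hi ih => rw [sum_insert hi, prod_insert hi, AddChar.map_add_eq_mul, ih]

theorem two_div_le_sin {m q : ℕ} (hm : 0 < m) (hmq : m < q) :
    2 / (q : ℝ) ≤ Real.sin (Real.pi * m / q) := by
  have hpi := Real.pi_pos
  have hq : (0 : ℝ) < q := by exact_mod_cast hm.trans hmq
  have hm1 : (1 : ℝ) ≤ m := by exact_mod_cast hm
  have hmq1 : (m : ℝ) + 1 ≤ q := by exact_mod_cast hmq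
  by_cases h : 2 * (m : ℝ) ≤ q
  · refine le_trans ?_ (Real.mul_le_sin (by positivity) ?_)
    · rw [show 2 / Real.pi * (Real.pi * m / q) = 2 * m / q by field_simp]
      gcongr
      linarith
    · rw [div_le_div_iff₀ hq two_pos]
      nlinarith
  · rw [← Real.sin_pi_sub, show Real.pi - Real.pi * m / q = Real.pi * (q - m) / q by field_simp]
    refine le_trans ?_ (Real.mul_le_sin ?_ ?_)
    · rw [show 2 / Real.pi * (Real.pi * (q - m) / q) = 2 * (q - m) / q by field_simp]
      gcongr
      linarith
    · have : (0 : ℝ) ≤ q - m := by linarith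
      positivity
    · rw [div_le_div_iff₀ hq two_pos]
      push Not at h
      nlinarith

theorem abs_cos_le_exp {k q : ℕ} (hk : 0 < k) (hkq : k < q) (hq : Odd q) :
    |Real.cos (2 * Real.pi * k / q)| ≤ Real.exp (-2 / (q : ℝ) ^ 2) := by
  have hq0 : (0 : ℝ) < q := by exact_mod_cast hk.trans hkq
  have hsin : 2 / (q : ℝ) ≤ |Real.sin (2 * Real.pi * k / q)| := by
    obtain h | h : 2 * k < q ∨ q < 2 * k := by
      obtain ⟨r, hr⟩ := hq
      omega
    · have := two_div_le_sin (m := 2 * k) (by omega) h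
      refine (this.trans (le_abs_self _)).trans_eq ?_
      push_cast
      congr 2
      ring
    · have := two_div_le_sin (m := 2 * k - q) (q := q) (by omega) (by omega)
      refine (this.trans (le_abs_self _)).trans_eq ?_
      rw [Nat.cast_sub h.le, show Real.pi * (((2 * k : ℕ) : ℝ) - q) / q
        = 2 * Real.pi * k / q - Real.pi by push_cast; field_simp, Real.sin_sub_pi, abs_neg]
  have hsq : (2 / (q : ℝ)) ^ 2 ≤ Real.sin (2 * Real.pi * k / q) ^ 2 := by
    rw [← sq_abs (Real.sin _)]
    gcongr
  refine abs_le_of_sq_le_sq ?_ (Real.exp_pos _).le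
  rw [← Real.exp_nat_mul]
  have h1 := Real.sin_sq_add_cos_sq (2 * Real.pi * k / q)
  have h2 := Real.add_one_le_exp (((2 : ℕ) : ℝ) * (-2 / (q : ℝ) ^ 2))
  have h3 : ((2 : ℕ) : ℝ) * (-2 / (q : ℝ) ^ 2) = - (2 / (q : ℝ)) ^ 2 := by
    push_cast
    field_simp
  rw [h3] at h2 ⊢
  linarith

variable {q : ℕ} [Fact q.Prime]

theorem norm_stdAddChar_add_neg_le (hq2 : q ≠ 2) (w : ZMod q) :
    ‖(ZMod.stdAddChar w : ℂ) + ZMod.stdAddChar (-w)‖ ≤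
      2 * if w ≠ 0 then Real.exp (-2 / (q : ℝ) ^ 2) else 1 := by
  by_cases hw : w = 0
  · subst hw
    norm_num
  have hre : (ZMod.stdAddChar w : ℂ).re = Real.cos (2 * Real.pi * w.val / q) := by
    rw [ZMod.stdAddChar_apply, ZMod.toCircle_apply, ← Complex.exp_ofReal_mul_I_re]
    congr 2
    push_cast
    ring
  rw [AddChar.map_neg_eq_conj, Complex.add_conj, Complex.norm_real, hre, if_pos hw,
    Real.norm_eq_abs, abs_mul, abs_two]
  gcongr
  refine abs_cos_le_exp ?_ (ZMod.val_lt w) ((Fact.out : q.Prime).odd_of_ne_two hq2)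
  exact Nat.pos_of_ne_zero ((ZMod.val_ne_zero w).2 hw)

/-- The coefficient of the sign `σ i j` in the form `b ⬝ M a`. -/
def signCoeff {n : ℕ} (a b : Fin n → ZMod q) (i j : Fin n) : ZMod q :=
  if i < j then a i * b j + a j * b i else if i = j then a i * b i else 0

theorem dotProduct_signMatrix_mulVec {n : ℕ} (σ : Fin n → Fin n → Bool) (a b : Fin n → ZMod q) :
    b ⬝ᵥ ((signMatrix n σ).map (Int.cast : ℤ → ZMod q)).mulVec a =
      ∑ i, ∑ j, if σ i j then signCoeff a b i j else -signCoeff a b i j := by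
  set s : Fin n → Fin n → ZMod q := fun i j => if σ i j then 1 else -1 with hs
  have hR : ∀ i j, (if σ i j then signCoeff a b i j else -signCoeff a b i j) =
      (if i < j then s i j * (a j * b i) else 0) + (if i < j then s i j * (a i * b j) else 0) +
        (if i = j then s i j * (a j * b i) else 0) := by
    intro i j
    rcases lt_trichotomy i j with h | rfl | h
    · simp only [signCoeff, hs, h, h.ne, if_true, if_false]
      split_ifs <;> ring
    · simp [signCoeff, hs]
    · simp [signCoeff, h.not_gt, h.ne']
  have hL : ∀ i j, b i * (((signMatrix n σ i j : ℤ) : ZMod q) * a j) =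
      (if i < j then s i j * (a j * b i) else 0) + (if j < i then s j i * (a j * b i) else 0) +
        (if i = j then s i j * (a j * b i) else 0) := by
    intro i j
    rcases lt_trichotomy i j with h | rfl | h
    · simp only [signMatrix, hs, h, h.ne, h.not_gt, if_true, if_false, min_eq_left h.le,
        max_eq_right h.le]
      split_ifs <;> push_cast <;> ring
    · simp only [signMatrix, hs, lt_irrefl, min_self, max_self, if_true, if_false]
      split_ifs <;> push_cast <;> ring
    · simp only [signMatrix, hs, h, h.ne', h.not_gt, if_true, if_false, min_eq_right h.le,
        max_eq_left h.le]
      split_ifs <;> push_cast <;> ring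
  simp only [dotProduct, Matrix.mulVec, Matrix.map_apply, mul_sum, hL, hR, sum_add_distrib]
  congr 2
  rw [sum_comm]

theorem norm_sum_stdAddChar_le (hq2 : q ≠ 2) {n : ℕ} (a b : Fin n → ZMod q) :
    ‖∑ σ : Fin n → Fin n → Bool, (ZMod.stdAddChar
        (b ⬝ᵥ ((signMatrix n σ).map (Int.cast : ℤ → ZMod q)).mulVec a) : ℂ)‖ ≤
      Fintype.card (Fin n → Fin n → Bool) * Real.exp (-(nonorthCount a b / (q : ℝ) ^ 2)) := by
  have hfac : ∑ σ : Fin n → Fin n → Bool, (ZMod.stdAddChar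
        (b ⬝ᵥ ((signMatrix n σ).map (Int.cast : ℤ → ZMod q)).mulVec a) : ℂ) =
      ∏ i, ∏ j, ((ZMod.stdAddChar (signCoeff a b i j) : ℂ) +
        ZMod.stdAddChar (-signCoeff a b i j)) := by
    have h1 : ∀ i j, ((ZMod.stdAddChar (signCoeff a b i j) : ℂ) +
        ZMod.stdAddChar (-signCoeff a b i j)) = ∑ t : Bool,
          (ZMod.stdAddChar (if t then signCoeff a b i j else -signCoeff a b i j) : ℂ) := by
      intro i j
      simp
    simp only [h1, dotProduct_signMatrix_mulVec, addChar_map_sum]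
    simp only [prod_univ_sum, Fintype.piFinset_univ]
  have hcount : nonorthCount a b ≤ 2 * #{p : Fin n × Fin n | signCoeff a b p.1 p.2 ≠ 0} := by
    have hsub : ({p : Fin n × Fin n | a p.1 * b p.2 + a p.2 * b p.1 ≠ 0} : Finset _) ⊆
        ({p : Fin n × Fin n | signCoeff a b p.1 p.2 ≠ 0} : Finset _) ∪
        (({p : Fin n × Fin n | signCoeff a b p.1 p.2 ≠ 0} : Finset _).image Prod.swap) := by
      rintro ⟨i, j⟩ hp
      simp only [mem_filter, mem_univ, true_and, mem_union, mem_image, Prod.exists,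
        Prod.swap_prod_mk, Prod.mk.injEq] at hp ⊢
      rcases lt_trichotomy i j with h | rfl | h
      · left
        simpa [signCoeff, h] using hp
      · left
        simp only [signCoeff, lt_irrefl, if_true, if_false]
        intro h0
        exact hp (by rw [h0, add_zero])
      · right
        refine ⟨j, i, ?_, rfl, rfl⟩
        simp only [signCoeff, h, if_true]
        rwa [add_comm]
    have := (card_le_card hsub).trans (card_union_le _ _)
    have h' := card_image_le (s := ({p : Fin n × Fin n | signCoeff a b p.1 p.2 ≠ 0} : Finset _))
      (f := Prod.swap)
    unfold nonorthCount
    omega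
  calc _ = ∏ i, ∏ j, ‖(ZMod.stdAddChar (signCoeff a b i j) : ℂ) +
        ZMod.stdAddChar (-signCoeff a b i j)‖ := by
        rw [hfac, norm_prod]
        simp_rw [norm_prod]
    _ ≤ ∏ i, ∏ j, (2 * if signCoeff a b i j ≠ 0 then Real.exp (-2 / (q : ℝ) ^ 2) else 1) := by
        refine prod_le_prod (fun i _ => prod_nonneg fun j _ => norm_nonneg _) fun i _ =>
          prod_le_prod (fun j _ => norm_nonneg _) fun j _ => norm_stdAddChar_add_neg_le hq2 _
    _ = Fintype.card (Fin n → Fin n → Bool) *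
          Real.exp (-2 / (q : ℝ) ^ 2) ^ #{p : Fin n × Fin n | signCoeff a b p.1 p.2 ≠ 0} := by
        simp_rw [prod_mul_distrib]
        congr 1
        · simp
        · rw [← Fintype.prod_prod_type' (f := fun i j =>
            if signCoeff a b i j ≠ 0 then Real.exp (-2 / (q : ℝ) ^ 2) else 1), prod_ite]
          simp
    _ ≤ _ := by
        gcongr
        rw [← Real.exp_nat_mul]
        gcongr
        have : (nonorthCount a b : ℝ) ≤ 2 * #{p : Fin n × Fin n | signCoeff a b p.1 p.2 ≠ 0} := by
          exact_mod_cast hcount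
        rw [mul_div_assoc', ← neg_div]
        gcongr
        linarith

theorem sum_stdAddChar_dotProduct {n : ℕ} (x : Fin n → ZMod q) :
    ∑ b : Fin n → ZMod q, (ZMod.stdAddChar (b ⬝ᵥ x) : ℂ) = if x = 0 then (q : ℂ) ^ n else 0 := by
  simp only [dotProduct, addChar_map_sum]
  rw [← Fintype.piFinset_univ, ← prod_univ_sum (fun _ : Fin n => (univ : Finset (ZMod q)))
    (fun i c => (ZMod.stdAddChar (c * x i) : ℂ))]
  simp only [AddChar.sum_mulShift _ (ZMod.isPrimitive_stdAddChar q), ZMod.card]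
  split_ifs with h
  · simp [h]
  · obtain ⟨i, hi⟩ := Function.ne_iff.1 h
    exact prod_eq_zero (mem_univ i) (by simp [show x i ≠ 0 from hi])

theorem expKernel_le_sum_exp (hq2 : q ≠ 2) (n : ℕ) :
    expKernel n q ≤ ((q : ℝ) ^ n)⁻¹ * ∑ a : Fin n → ZMod q, ∑ b : Fin n → ZMod q,
      Real.exp (-(nonorthCount a b / (q : ℝ) ^ 2)) := by
  have hq0 : (0 : ℝ) < q := by exact_mod_cast (Fact.out : q.Prime).pos
  have hT : (0 : ℝ) < Fintype.card (Fin n → Fin n → Bool) := by exact_mod_cast Fintype.card_pos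
  rw [expKernel, div_le_iff₀ hT, ← mul_le_mul_iff_right₀ (pow_pos hq0 n), ← mul_assoc,
    ← mul_assoc, mul_inv_cancel₀ (pow_pos hq0 n).ne', one_mul]
  set M := fun σ : Fin n → Fin n → Bool => (signMatrix n σ).map (Int.cast : ℤ → ZMod q)
  have hcast : (((q : ℝ) ^ n * ∑ σ : Fin n → Fin n → Bool,
      (Nat.card {a : Fin n → ZMod q // (M σ).mulVec a = 0} : ℝ) : ℝ) : ℂ) =
      ∑ a : Fin n → ZMod q, ∑ b : Fin n → ZMod q, ∑ σ : Fin n → Fin n → Bool,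
        (ZMod.stdAddChar (b ⬝ᵥ (M σ).mulVec a) : ℂ) := by
    have h1 : ∀ a : Fin n → ZMod q, ∑ b : Fin n → ZMod q, ∑ σ : Fin n → Fin n → Bool,
        (ZMod.stdAddChar (b ⬝ᵥ (M σ).mulVec a) : ℂ) =
        ∑ σ : Fin n → Fin n → Bool, if (M σ).mulVec a = 0 then (q : ℂ) ^ n else 0 := by
      intro a
      rw [sum_comm]
      simp only [sum_stdAddChar_dotProduct]
    simp only [h1]
    rw [sum_comm]
    push_cast
    rw [mul_sum]
    refine sum_congr rfl fun σ _ => ?_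
    rw [← sum_filter, sum_const, nsmul_eq_mul, mul_comm, Nat.card_eq_fintype_card,
      Fintype.card_subtype]
  rw [← Complex.norm_of_nonneg (r := (q : ℝ) ^ n * _) (by positivity), hcast, sum_mul]
  refine (norm_sum_le _ _).trans (sum_le_sum fun a _ => ?_)
  rw [sum_mul]
  refine (norm_sum_le _ _).trans (sum_le_sum fun b _ => ?_)
  rw [mul_comm]
  exact norm_sum_stdAddChar_le hq2 a b

end Fourier

section Asymptotics

variable {q : ℕ} [Fact q.Prime]

theorem sum_exp_nonorthCount_le (hq2 : q ≠ 2) {n : ℕ} {S y : ℝ} (hS : 0 ≤ S) (hy : 0 < y)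
    (hy1 : y ≤ 1) :
    ∑ a : Fin n → ZMod q, ∑ b : Fin n → ZMod q, Real.exp (-(nonorthCount a b / (q : ℝ) ^ 2)) ≤
      2 * (q : ℝ) ^ n + y ^ (-S) * (1 + ((q : ℝ) ^ 2 - 1) * y) ^ n +
        (q : ℝ) ^ (2 * n) * Real.exp (-(S ^ 2 / (4 * (q : ℝ) ^ 2))) +
        2 * (q : ℝ) ^ n * ((1 + ((q : ℝ) - 1) * Real.exp (-(S / (2 * (q : ℝ) ^ 2)))) ^ n - 1) := by
  have hq0 : (0 : ℝ) < q := by exact_mod_cast (Fact.out : q.Prime).pos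
  have h20 : (2 : ZMod q) ≠ 0 := by
    intro h
    have : ((2 : ℕ) : ZMod q) = 0 := by exact_mod_cast h
    rw [ZMod.natCast_eq_zero_iff] at this
    exact hq2 ((Nat.prime_dvd_prime_iff_eq Fact.out Nat.prime_two).1 this)
  set x := Real.exp (-(S / (2 * (q : ℝ) ^ 2))) with hx
  have hx0 : 0 < x := Real.exp_pos _
  set g : (Fin n → ZMod q) → ℝ := fun b => x ^ #{i | b i ≠ 0} - if b = 0 then 1 else 0 with hg
  have hg0 : ∀ b, 0 ≤ g b := by
    intro b
    by_cases hb : b = 0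
    · simp [hg, hb]
    · simp only [hg, hb, if_false, sub_zero]
      positivity
  have key : ∀ a b : Fin n → ZMod q, Real.exp (-(nonorthCount a b / (q : ℝ) ^ 2)) ≤
      (((if a = 0 then 1 else 0) + (if b = 0 then 1 else 0)) +
        y ^ (-S) * y ^ #{i | a i ≠ 0 ∨ b i ≠ 0} + Real.exp (-(S ^ 2 / (4 * (q : ℝ) ^ 2)))) +
        (g a + g b) := by
    intro a b
    have hle1 : Real.exp (-(nonorthCount a b / (q : ℝ) ^ 2)) ≤ 1 := by
      rw [Real.exp_le_one_iff]
      simp only [Left.neg_nonpos_iff]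
      positivity
    have t1 : (0 : ℝ) ≤ if a = 0 then 1 else 0 := by split_ifs <;> norm_num
    have t2 : (0 : ℝ) ≤ if b = 0 then 1 else 0 := by split_ifs <;> norm_num
    have t3 : 0 ≤ y ^ (-S) * y ^ #{i | a i ≠ 0 ∨ b i ≠ 0} := by positivity
    have t4 := Real.exp_pos (-(S ^ 2 / (4 * (q : ℝ) ^ 2)))
    have t5 := hg0 a
    have t6 := hg0 b
    by_cases ha : a = 0
    · simp only [ha, if_true] at *
      linarith
    by_cases hb : b = 0
    · simp only [hb, if_true] at *
      linarith
    by_cases hs : (#{i | a i ≠ 0 ∨ b i ≠ 0} : ℝ) ≤ S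
    · have : 1 ≤ y ^ (-S) * y ^ #{i | a i ≠ 0 ∨ b i ≠ 0} := by
        rw [← Real.rpow_natCast, ← Real.rpow_add hy]
        exact Real.one_le_rpow_of_pos_of_le_one_of_nonpos hy hy1 (by linarith)
      linarith
    push Not at hs
    have hexp : ∀ m : ℕ, #{i | a i ≠ 0 ∨ b i ≠ 0} * m ≤ 2 * nonorthCount a b →
        Real.exp (-(nonorthCount a b / (q : ℝ) ^ 2)) ≤ x ^ m := by
      intro m hm
      rw [hx, ← Real.exp_nat_mul]
      gcongr
      have hm' : (#{i | a i ≠ 0 ∨ b i ≠ 0} : ℝ) * m ≤ 2 * nonorthCount a b := by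
        exact_mod_cast hm
      have : S * m ≤ 2 * nonorthCount a b := le_trans (by gcongr) hm'
      rw [mul_neg, neg_le_neg_iff, mul_div_assoc', div_le_div_iff₀ (by positivity) (by positivity)]
      nlinarith [pow_pos hq0 2]
    rcases nonorthCount_trichotomy h20 a b with h | h | h
    · have h' : (#{i | a i ≠ 0 ∨ b i ≠ 0} : ℝ) ^ 2 ≤ 4 * nonorthCount a b := by exact_mod_cast h
      have : Real.exp (-(nonorthCount a b / (q : ℝ) ^ 2)) ≤
          Real.exp (-(S ^ 2 / (4 * (q : ℝ) ^ 2))) := by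
        rw [Real.exp_le_exp, neg_le_neg_iff]
        have : S ^ 2 ≤ 4 * nonorthCount a b := le_trans (by gcongr) h'
        rw [div_le_div_iff₀ (by positivity) (by positivity)]
        nlinarith [pow_pos hq0 2]
      linarith
    · have := hexp _ h
      have hgb : g b = x ^ #{i | b i ≠ 0} := by simp [hg, hb]
      linarith
    · have := hexp _ h
      have hga : g a = x ^ #{i | a i ≠ 0} := by simp [hg, ha]
      linarith
  refine (sum_le_sum fun a _ => sum_le_sum fun b _ => key a b).trans_eq ?_
  have hsg : ∑ b, g b = (1 + ((q : ℝ) - 1) * x) ^ n - 1 := by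
    rw [hg, sum_sub_distrib, sum_pow_card_ne_zero]
    simp [ZMod.card]
  simp only [sum_add_distrib, ← mul_sum, sum_pow_card_support_pair, hsg, sum_const, card_univ,
    Fintype.card_fun, ZMod.card, Fintype.card_fin, nsmul_eq_mul, sum_ite_eq', mem_univ, if_true]
  simp
  ring

theorem expKernel_le (hq2 : q ≠ 2) {n : ℕ} (hL : 128 ≤ Real.log n)
    (hqn : (q : ℝ) ^ 2 * Real.log n ^ 4 ≤ n) : expKernel n q ≤ 2 + 11 / n := by
  set L := Real.log n with hLdef
  have hq3 : (3 : ℝ) ≤ q := by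
    have := (Fact.out : q.Prime).two_le
    exact_mod_cast (by omega : 3 ≤ q)
  have hq0 : (0 : ℝ) < q := by linarith
  have hn0 : (0 : ℝ) < n := by
    refine lt_of_lt_of_le ?_ hqn
    positivity
  have hn1 : (1 : ℝ) ≤ n := by exact_mod_cast (by exact_mod_cast hn0 : 0 < n)
  have hexpL : Real.exp L = n := Real.exp_log hn0
  have hL0 : 0 < L := by linarith
  have hL4 : 1 ≤ L ^ 4 := one_le_pow₀ (by linarith)
  have hq2n : (q : ℝ) ^ 2 ≤ n := le_trans (le_mul_of_one_le_right (by positivity) hL4) hqn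
  have hqlen : (q : ℝ) ≤ n := by nlinarith
  set S := (n : ℝ) / (4 * L) with hS
  set y := ((n : ℝ) ^ 2)⁻¹ with hy
  have hy0 : 0 < y := by positivity
  have hsmall : y ^ (-S) * (1 + ((q : ℝ) ^ 2 - 1) * y) ^ n ≤
      (q : ℝ) ^ n * (6 / n) := by
    have h1 : y ^ (-S) = Real.exp (n / 2) := by
      rw [hy, Real.rpow_neg (by positivity), Real.inv_rpow (by positivity), inv_inv,
        Real.rpow_def_of_pos (by positivity), Real.log_pow, ← hLdef, hS]
      congr 1
      field_simp
      norm_num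
    have h2 : (1 + ((q : ℝ) ^ 2 - 1) * y) ^ n ≤ Real.exp 1 := by
      have : 1 + ((q : ℝ) ^ 2 - 1) * y ≤ Real.exp (1 / n) := by
        refine le_trans ?_ (Real.add_one_le_exp _)
        have : (q : ℝ) ^ 2 * y ≤ 1 / n := by
          rw [hy, ← div_eq_mul_inv, div_le_div_iff₀ (by positivity) (by positivity)]
          nlinarith
        linarith
      have hb : 0 ≤ 1 + ((q : ℝ) ^ 2 - 1) * y := by
        have : 0 ≤ (q : ℝ) ^ 2 - 1 := by nlinarith
        positivity
      refine (pow_le_pow_left₀ hb this n).trans_eq ?_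
      rw [← Real.exp_nat_mul]
      congr 1
      field_simp
    have h3 : Real.exp n ≤ (q : ℝ) ^ n := by
      rw [← mul_one (n : ℝ), Real.exp_nat_mul]
      gcongr
      linarith [Real.exp_one_lt_d9]
    have h4 : Real.exp (n / 2) ≤ Real.exp n * (2 / n) := by
      have e1 : Real.exp n = Real.exp (n / 2) * Real.exp (n / 2) := by
        rw [← Real.exp_add]
        congr 1
        ring
      have e2 := Real.add_one_le_exp ((n : ℝ) / 2)
      rw [e1, mul_assoc]
      refine le_mul_of_one_le_right (Real.exp_pos _).le ?_
      rw [mul_div_assoc', one_le_div hn0]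
      linarith
    rw [h1]
    calc _ ≤ (Real.exp n * (2 / n)) * 3 :=
          mul_le_mul_of_nonneg h4 (h2.trans (by linarith [Real.exp_one_lt_d9]))
            (Real.exp_pos _).le (by norm_num)
      _ = Real.exp n * (6 / n) := by ring
      _ ≤ _ := by gcongr
  have hmid : (q : ℝ) ^ (2 * n) * Real.exp (-(S ^ 2 / (4 * (q : ℝ) ^ 2))) ≤
      (q : ℝ) ^ n * (1 / n) := by
    have h1 : (n : ℝ) * L + n ≤ S ^ 2 / (4 * (q : ℝ) ^ 2) := by
      rw [le_div_iff₀ (by positivity), hS, div_pow, le_div_iff₀ (by positivity)]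
      have e : L + 1 ≤ L ^ 2 / 64 := by nlinarith
      calc _ = 64 * n * (L + 1) * L ^ 2 * (q : ℝ) ^ 2 := by ring
        _ ≤ 64 * n * (L ^ 2 / 64) * L ^ 2 * (q : ℝ) ^ 2 := by gcongr
        _ = n * ((q : ℝ) ^ 2 * L ^ 4) := by ring
        _ ≤ n * n := by gcongr
        _ = _ := by ring
    have h2 : Real.exp (-(S ^ 2 / (4 * (q : ℝ) ^ 2))) ≤ ((n : ℝ) ^ n)⁻¹ * (1 / n) := by
      calc _ ≤ Real.exp (-(n * L + n)) := by gcongr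
        _ = ((n : ℝ) ^ n)⁻¹ * Real.exp (-n) := by
          rw [neg_add, Real.exp_add, Real.exp_neg, Real.exp_nat_mul, hexpL]
        _ ≤ _ := by
          gcongr
          rw [Real.exp_neg, one_div]
          gcongr
          linarith [Real.add_one_le_exp (n : ℝ)]
    calc _ ≤ (q : ℝ) ^ (2 * n) * (((n : ℝ) ^ n)⁻¹ * (1 / n)) := by gcongr
      _ = (q : ℝ) ^ n * ((q : ℝ) ^ n * ((n : ℝ) ^ n)⁻¹) * (1 / n) := by ring
      _ ≤ (q : ℝ) ^ n * 1 * (1 / n) := by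
          gcongr
          rw [← div_eq_mul_inv, div_le_one (by positivity)]
          gcongr
      _ = _ := by ring
  have hlast : (1 + ((q : ℝ) - 1) * Real.exp (-(S / (2 * (q : ℝ) ^ 2)))) ^ n - 1 ≤ 2 / n := by
    have h1 : 3 * L ≤ S / (2 * (q : ℝ) ^ 2) := by
      rw [le_div_iff₀ (by positivity), hS, le_div_iff₀ (by positivity)]
      calc _ = 24 * L ^ 2 * (q : ℝ) ^ 2 := by ring
        _ ≤ L ^ 2 * L ^ 2 * (q : ℝ) ^ 2 := by
          gcongr
          nlinarith
        _ = (q : ℝ) ^ 2 * L ^ 4 := by ring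
        _ ≤ n := hqn
    have h2 : Real.exp (-(S / (2 * (q : ℝ) ^ 2))) ≤ ((n : ℝ) ^ 3)⁻¹ := by
      calc _ ≤ Real.exp (-(3 * L)) := by gcongr
        _ = _ := by
          rw [Real.exp_neg, ← hexpL, ← Real.exp_nat_mul]
          norm_num
    have h3 : ((q : ℝ) - 1) * Real.exp (-(S / (2 * (q : ℝ) ^ 2))) ≤ 1 / n ^ 2 := by
      calc _ ≤ (n : ℝ) * ((n : ℝ) ^ 3)⁻¹ := by
            gcongr
            linarith
        _ = _ := by field_simp
    have h4 : (1 + ((q : ℝ) - 1) * Real.exp (-(S / (2 * (q : ℝ) ^ 2)))) ^ n ≤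
        Real.exp (1 / n) := by
      have hb : 0 ≤ 1 + ((q : ℝ) - 1) * Real.exp (-(S / (2 * (q : ℝ) ^ 2))) := by
        have : 0 ≤ (q : ℝ) - 1 := by linarith
        positivity
      calc _ ≤ Real.exp (1 / n ^ 2) ^ n := by
            gcongr
            linarith [Real.add_one_le_exp (1 / (n : ℝ) ^ 2)]
        _ = _ := by
          rw [← Real.exp_nat_mul]
          congr 1
          field_simp
    have h5 : |Real.exp (1 / n) - 1| ≤ 2 * |1 / (n : ℝ)| := by
      refine Real.abs_exp_sub_one_le ?_
      rw [abs_of_pos (by positivity), div_le_one hn0]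
      exact hn1
    rw [abs_of_pos (a := 1 / (n : ℝ)) (by positivity)] at h5
    have := le_abs_self (Real.exp (1 / n) - 1)
    have e : 2 * (1 / (n : ℝ)) = 2 / n := by ring
    linarith
  have hqn0 : (0 : ℝ) < (q : ℝ) ^ n := by positivity
  refine (expKernel_le_sum_exp hq2 n).trans ?_
  rw [inv_mul_le_iff₀ hqn0]
  refine (sum_exp_nonorthCount_le hq2 (S := S) (y := y) (by positivity) hy0
    (inv_le_one_of_one_le₀ (one_le_pow₀ hn1))).trans ?_
  have hlast' := mul_le_mul_of_nonneg_left hlast (by positivity : 0 ≤ 2 * (q : ℝ) ^ n)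
  have e : (q : ℝ) ^ n * (2 + 11 / n) = 2 * (q : ℝ) ^ n + (q : ℝ) ^ n * (6 / n) +
    (q : ℝ) ^ n * (1 / n) + 2 * (q : ℝ) ^ n * (2 / n) := by ring
  linarith

end Asymptotics

/-- There is a constant `C > 0` such that for every `ε > 0`, for all sufficiently
large `n` and every odd prime `q ≤ n^(1/2)/(log n)^C`, the expected number of
vectors `a ∈ (ℤ/qℤ)^n` with `M_n · a = 0` is at most `2 + ε`. -/
theorem expected_kernel_bound :
    ∃ C > (0 : ℝ), ∀ ε > (0 : ℝ), ∃ N : ℕ, ∀ n : ℕ, N ≤ n → ∀ q : ℕ,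
      q.Prime → q ≠ 2 → (q : ℝ) ≤ Real.sqrt n / (Real.log n) ^ C →
      expKernel n q ≤ 2 + ε := by
  refine ⟨2, two_pos, fun ε hε => ?_⟩
  have hlog := (Real.tendsto_log_atTop.comp tendsto_natCast_atTop_atTop).eventually_ge_atTop 128
  have hlin := (tendsto_natCast_atTop_atTop (R := ℝ)).eventually_ge_atTop (11 / ε)
  obtain ⟨N, hN⟩ := Filter.eventually_atTop.1 (hlog.and hlin)
  refine ⟨N, fun n hn q hq hq2 hle => ?_⟩
  obtain ⟨hL, hnε⟩ := hN n hn
  simp only [Function.comp_apply] at hL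
  have : Fact q.Prime := ⟨hq⟩
  have hL0 : 0 < Real.log n := by linarith
  have hqn : (q : ℝ) ^ 2 * Real.log n ^ 4 ≤ n := by
    rw [Real.rpow_two, le_div_iff₀ (by positivity)] at hle
    have := pow_le_pow_left₀ (by positivity) hle 2
    rw [Real.sq_sqrt (by positivity)] at this
    calc _ = ((q : ℝ) * Real.log n ^ 2) ^ 2 := by ring
      _ ≤ n := this
  have hn0 : (0 : ℝ) < n := lt_of_lt_of_le (by positivity) hnε
  have := expKernel_le hq2 hL hqn
  have h11 : 11 / (n : ℝ) ≤ ε := by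
    rw [div_le_iff₀ hε] at hnε
    rw [div_le_iff₀ hn0]
    linarith
  linarith
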